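/- Let X = (X_1,…,X_n) be a centered Gaussian vector with E[X_i²] = 1 for all i, and M_n = max_{1≤i≤n} X_i. Then for every i ∈ {1,…,n}, P(X_i = M_n) ≤ 2 exp(−E[M_n]²/8). -/

import Mathlib

open MeasureTheory ProbabilityTheory Real

lemma MeasureTheory.Integrable.fun_sub {α : Type*} [MeasurableSpace α] {μ : Measure α} {f g : α → ℝ}
    (hf : Integrable f μ) (hg : Integrable g μ) : Integrable (fun x => f x - g x) μ := hf.sub hg

structure Cls {n : ℕ} (β : ℝ) (h : (Fin n → ℝ) → ℝ) (a : (Fin n → ℝ) → Fin n → ℝ) : Prop where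
  cont : ∀ j, Continuous fun x => a x j
  nonneg : ∀ x j, 0 ≤ a x j
  sum_one : ∀ x, ∑ j, a x j = 1
  lower : ∀ x y, ∑ j, a x j * y j ≤ h (x + y) - h x
  upper : ∀ x y, h (x + y) - h x - ∑ j, a x j * y j ≤ β * ‖y‖ ^ 2

lemma simplex_abs {n : ℕ} {a : Fin n → ℝ} (h0 : ∀ j, 0 ≤ a j) (h1 : ∑ j, a j = 1)
    (y : Fin n → ℝ) : |∑ j, a j * y j| ≤ ‖y‖ := by
  calc |∑ j, a j * y j| ≤ ∑ j, |a j * y j| := Finset.abs_sum_le_sum_abs _ _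
    _ ≤ ∑ j, a j * ‖y‖ := by
        refine Finset.sum_le_sum fun j _ => ?_
        rw [abs_mul, abs_of_nonneg (h0 j)]
        exact mul_le_mul_of_nonneg_left (norm_le_pi_norm y j) (h0 j)
    _ = ‖y‖ := by rw [← Finset.sum_mul, h1, one_mul]

lemma Cls.a_le_one {n : ℕ} {β : ℝ} {h : (Fin n → ℝ) → ℝ} {a : (Fin n → ℝ) → Fin n → ℝ}
    (H : Cls β h a) (x : Fin n → ℝ) (j : Fin n) : a x j ≤ 1 := by
  rw [← H.sum_one x]
  exact Finset.single_le_sum (f := fun j => a x j) (fun j _ => H.nonneg x j) (Finset.mem_univ j)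

lemma Cls.ge {n : ℕ} {β : ℝ} {h : (Fin n → ℝ) → ℝ} {a : (Fin n → ℝ) → Fin n → ℝ}
    (H : Cls β h a) (x y : Fin n → ℝ) : h x - ‖y‖ ≤ h (x + y) := by
  have h1 := H.lower x y
  have h2 := (abs_le.1 (simplex_abs (H.nonneg x) (H.sum_one x) y)).1
  linarith

lemma Cls.le {n : ℕ} {β : ℝ} {h : (Fin n → ℝ) → ℝ} {a : (Fin n → ℝ) → Fin n → ℝ}
    (H : Cls β h a) (x y : Fin n → ℝ) : h (x + y) ≤ h x + ‖y‖ := by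
  have := H.ge (x + y) (-y)
  simp at this
  linarith

lemma Cls.abs_le {n : ℕ} {β : ℝ} {h : (Fin n → ℝ) → ℝ} {a : (Fin n → ℝ) → Fin n → ℝ}
    (H : Cls β h a) (x y : Fin n → ℝ) : |h (x + y)| ≤ |h x| + ‖y‖ := by
  have h1 := H.ge x y
  have h2 := H.le x y
  rw [_root_.abs_le]
  constructor
  · linarith [neg_abs_le (h x)]
  · linarith [le_abs_self (h x)]

lemma Cls.continuous {n : ℕ} {β : ℝ} {h : (Fin n → ℝ) → ℝ} {a : (Fin n → ℝ) → Fin n → ℝ}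
    (H : Cls β h a) : Continuous h := by
  have : LipschitzWith 1 h := by
    refine LipschitzWith.of_le_add fun x y => ?_
    have := H.le y (x - y)
    rw [dist_eq_norm]
    simpa using this
  exact this.continuous

structure Good {n : ℕ} (ν : Measure (Fin n → ℝ)) : Prop where
  prob : IsProbabilityMeasure ν
  expInt : ∀ c : ℝ, Integrable (fun y => exp (c * ‖y‖)) ν
  mean : ∀ j, ∫ y, y j ∂ν = 0
  mgf_le : ∀ (a : Fin n → ℝ), (∀ j, 0 ≤ a j) → ∑ j, a j = 1 → ∀ t : ℝ,
    ∫ y, exp (t * ∑ j, a j * y j) ∂ν ≤ exp (t ^ 2 / 2)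
  rot : (ν.prod ν).map (fun p => (√2)⁻¹ • (p.1 + p.2)) = ν

lemma Good.powInt {n : ℕ} {ν : Measure (Fin n → ℝ)} (G : Good ν) (k : ℕ) (c : ℝ) :
    Integrable (fun y => ‖y‖ ^ k * exp (c * ‖y‖)) ν := by
  refine ((G.expInt (c + 1)).const_mul (k.factorial : ℝ)).mono' (by fun_prop) ?_
  refine Filter.Eventually.of_forall fun y => ?_
  rw [Real.norm_of_nonneg (by positivity), add_mul, one_mul, exp_add]
  have h1 : ‖y‖ ^ k / k.factorial ≤ exp ‖y‖ := Real.pow_div_factorial_le_exp _ (norm_nonneg _) k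
  rw [div_le_iff₀ (by positivity)] at h1
  nlinarith [exp_pos (c * ‖y‖)]

lemma Good.powInt' {n : ℕ} {ν : Measure (Fin n → ℝ)} (G : Good ν) (k : ℕ) :
    Integrable (fun y => ‖y‖ ^ k) ν := by
  simpa using G.powInt k 0

lemma Good.normInt {n : ℕ} {ν : Measure (Fin n → ℝ)} (G : Good ν) :
    Integrable (fun y => ‖y‖) ν := by
  simpa using G.powInt 1 0

lemma Good.coordInt {n : ℕ} {ν : Measure (Fin n → ℝ)} (G : Good ν) (j : Fin n) :
    Integrable (fun y => y j) ν :=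
  G.normInt.mono' (measurable_pi_apply j).aestronglyMeasurable (Filter.Eventually.of_forall fun y => norm_le_pi_norm y j)

lemma Good.linInt {n : ℕ} {ν : Measure (Fin n → ℝ)} (G : Good ν) (a : Fin n → ℝ) :
    Integrable (fun y => ∑ j, a j * y j) ν :=
  integrable_finsetSum _ fun j _ => (G.coordInt j).const_mul _

lemma Good.lin_zero {n : ℕ} {ν : Measure (Fin n → ℝ)} (G : Good ν) (a : Fin n → ℝ) :
    ∫ y, ∑ j, a j * y j ∂ν = 0 := by
  rw [integral_finsetSum _ fun j _ => (G.coordInt j).const_mul _]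
  simp [integral_const_mul, G.mean]

lemma Good.hInt {n : ℕ} {ν : Measure (Fin n → ℝ)} (G : Good ν) {β : ℝ} {h : (Fin n → ℝ) → ℝ}
    {a : (Fin n → ℝ) → Fin n → ℝ} (H : Cls β h a) (x : Fin n → ℝ) (u : ℝ) :
    Integrable (fun y => h (x + u • y)) ν := by
  have := G.prob
  have hc := H.continuous
  refine ((integrable_const |h x|).add (G.normInt.const_mul |u|)).mono' 
    (by fun_prop) (Filter.Eventually.of_forall fun y => ?_)
  have := H.abs_le x (u • y)
  rw [norm_smul] at this
  simpa using this

lemma Good.expHInt {n : ℕ} {ν : Measure (Fin n → ℝ)} (G : Good ν) {β : ℝ} {h : (Fin n → ℝ) → ℝ}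
    {a : (Fin n → ℝ) → Fin n → ℝ} (H : Cls β h a) (x : Fin n → ℝ) (u l : ℝ) (hl : 0 ≤ l) :
    Integrable (fun y => exp (-l * h (x + u • y))) ν := by
  have hc := H.continuous
  refine ((G.expInt (l * |u|)).const_mul (exp (-l * h x))).mono' 
    (by fun_prop) (Filter.Eventually.of_forall fun y => ?_)
  have := H.ge x (u • y)
  rw [norm_smul, Real.norm_eq_abs] at this
  rw [Real.norm_of_nonneg (exp_pos _).le, ← exp_add]
  apply exp_le_exp.2
  nlinarith

lemma Cls.avg {n : ℕ} {ν : Measure (Fin n → ℝ)} (G : Good ν) {β : ℝ} {h : (Fin n → ℝ) → ℝ}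
    {a : (Fin n → ℝ) → Fin n → ℝ} (H : Cls β h a) (u : ℝ) :
    Cls β (fun x => ∫ y, h (x + u • y) ∂ν) (fun x j => ∫ y, a (x + u • y) j ∂ν) := by
  have := G.prob
  have hc := H.cont
  have hab : ∀ x j, ‖a x j‖ ≤ 1 := fun x j => by
    rw [Real.norm_of_nonneg (H.nonneg x j)]; exact H.a_le_one x j
  have hai : ∀ x j, Integrable (fun y => a (x + u • y) j) ν := fun x j => by
    refine (integrable_const (1:ℝ)).mono' ?_ (Filter.Eventually.of_forall fun y => hab _ j)
    exact ((hc j).comp (by fun_prop : Continuous fun y => x + u • y)).aestronglyMeasurable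
  have hsum : ∀ x z : Fin n → ℝ, ∑ j, (∫ y, a (x + u • y) j ∂ν) * z j
      = ∫ y, ∑ j, a (x + u • y) j * z j ∂ν := fun x z => by
    rw [integral_finsetSum _ fun j _ => (hai x j).mul_const _]
    simp [integral_mul_const]
  have hsi : ∀ x z : Fin n → ℝ, Integrable (fun y => ∑ j, a (x + u • y) j * z j) ν := fun x z =>
    integrable_finsetSum _ fun j _ => (hai x j).mul_const _
  have hsw : ∀ x z y : Fin n → ℝ, x + z + u • y = x + u • y + z := fun x z y => by abel
  refine ⟨fun j => ?_, fun x j => integral_nonneg fun y => H.nonneg _ j, fun x => ?_, fun x z => ?_,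
    fun x z => ?_⟩
  · refine continuous_of_dominated (bound := fun _ => 1) (fun x => (hai x j).aestronglyMeasurable)
      (fun x => Filter.Eventually.of_forall fun y => hab _ j) (integrable_const _)
      (Filter.Eventually.of_forall fun y => ?_)
    exact (hc j).comp (by fun_prop : Continuous fun x => x + u • y)
  · rw [← integral_finsetSum _ fun j _ => hai x j]
    simp [H.sum_one]
  · rw [hsum, ← integral_sub (G.hInt H _ _) (G.hInt H _ _)]
    refine integral_mono (hsi x z) ((G.hInt H _ _).fun_sub (G.hInt H _ _)) fun y => ?_
    simp only [hsw]
    exact H.lower _ _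
  · rw [hsum, ← integral_sub (G.hInt H _ _) (G.hInt H _ _),
      ← integral_sub ((G.hInt H _ _).fun_sub (G.hInt H _ _)) (hsi x z)]
    have : β * ‖z‖ ^ 2 = ∫ y, β * ‖z‖ ^ 2 ∂ν := by simp
    rw [this]
    refine integral_mono (((G.hInt H _ _).fun_sub (G.hInt H _ _)).fun_sub (hsi x z)) (integrable_const _)
      fun y => ?_
    simp only [hsw]
    exact H.upper _ _

/-- integral over the doubled step -/
lemma Good.double {n : ℕ} {ν : Measure (Fin n → ℝ)} (G : Good ν) (f : (Fin n → ℝ) → ℝ)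
    (hf : Continuous f) (x : Fin n → ℝ) (u : ℝ)
    (hi : Integrable (fun y => f (x + (√2 * u) • y)) ν) :
    ∫ y, f (x + (√2 * u) • y) ∂ν = ∫ y, ∫ z, f (x + u • y + u • z) ∂ν ∂ν := by
  have := G.prob
  have key : ∀ p : (Fin n → ℝ) × (Fin n → ℝ), f (x + (√2 * u) • ((√2)⁻¹ • (p.1 + p.2)))
      = f (x + u • p.1 + u • p.2) := fun p => by
    rw [smul_smul, mul_right_comm, mul_inv_cancel₀ (by positivity), one_mul, smul_add, add_assoc]
  have hm : AEMeasurable (fun p : (Fin n → ℝ) × (Fin n → ℝ) => (√2)⁻¹ • (p.1 + p.2)) (ν.prod ν) := by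
    fun_prop
  have hi2 := hi
  rw [← G.rot] at hi2
  have hi3 := hi2.comp_aemeasurable hm
  conv_lhs => rw [← G.rot]
  rw [integral_map hm (by fun_prop)]
  simp only [key]
  have hi4 : Integrable (fun p : (Fin n → ℝ) × (Fin n → ℝ) => f (x + u • p.1 + u • p.2)) (ν.prod ν) :=
    hi3.congr (Filter.Eventually.of_forall key)
  rw [integral_prod _ hi4]

def Bd {n : ℕ} (ν : Measure (Fin n → ℝ)) (β l u ε : ℝ) : Prop :=
  ∀ h a, Cls (n := n) β h a → ∀ x, ∫ y, exp (-l * h (x + u • y)) ∂ν ≤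
    exp (-l * (∫ y, h (x + u • y) ∂ν) + ε)

lemma Bd.double {n : ℕ} {ν : Measure (Fin n → ℝ)} (G : Good ν) {β l u ε : ℝ} (hl : 0 ≤ l)
    (B : Bd ν β l u ε) : Bd ν β l (√2 * u) (2 * ε) := by
  intro h a H x
  have hc := H.continuous
  have e1 := G.double (fun x => exp (-l * h x)) (by fun_prop) x u (G.expHInt H _ _ _ hl)
  have e2 := G.double h hc x u (G.hInt H _ _)
  rw [e1, e2]
  have H' := H.avg G u
  have h1 := B _ _ H' x
  calc ∫ y, ∫ z, exp (-l * h (x + u • y + u • z)) ∂ν ∂ν 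
      ≤ ∫ y, exp (-l * (∫ z, h (x + u • y + u • z) ∂ν)) * exp ε ∂ν := by
        refine integral_mono_of_nonneg (Filter.Eventually.of_forall fun y => 
          integral_nonneg fun z => (exp_pos _).le) ((G.expHInt H' x u l hl).mul_const _)
          (Filter.Eventually.of_forall fun y => ?_)
        have := B h a H (x + u • y)
        rwa [exp_add] at this
    _ = (∫ y, exp (-l * (∫ z, h (x + u • y + u • z) ∂ν)) ∂ν) * exp ε := integral_mul_const _ _
    _ ≤ exp (-l * (∫ y, ∫ z, h (x + u • y + u • z) ∂ν ∂ν) + ε) * exp ε :=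
        mul_le_mul_of_nonneg_right h1 (exp_pos _).le
    _ = _ := by rw [← exp_add]; congr 1; ring

lemma exp_neg_le_quad {t : ℝ} (ht : 0 ≤ t) : exp (-t) ≤ 1 - t + t ^ 2 / 2 := by
  have h1 := Real.quadratic_le_exp_of_nonneg ht
  have h2 : exp (-t) * exp t = 1 := by rw [← exp_add]; simp
  have h3 : 0 < 1 - t + t ^ 2 / 2 := by nlinarith [sq_nonneg (t - 1)]
  have h4 : 1 ≤ (1 - t + t ^ 2 / 2) * exp t := by
    calc (1:ℝ) ≤ (1 - t + t ^ 2 / 2) * (1 + t + t ^ 2 / 2) := by nlinarith [sq_nonneg (t^2)]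
      _ ≤ _ := mul_le_mul_of_nonneg_left h1 h3.le
  by_contra hcon
  push Not at hcon
  have := mul_lt_mul_of_pos_right hcon (exp_pos t)
  linarith

lemma pointwise_bd {β l u A R N : ℝ} (hl : 0 ≤ l) (hu0 : 0 ≤ u) (hu1 : u ≤ 1)
    (hA : |A| ≤ N) (hR0 : 0 ≤ R) (hR : R ≤ β * (u ^ 2 * N ^ 2)) :
    exp (-l * (u * A + R)) ≤ exp (-l * u * A) - l * R
      + u ^ 3 * (l ^ 2 * β * N ^ 3 + l ^ 2 * β ^ 2 / 2 * (N ^ 4 * exp (l * N))) := by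
  have hN : 0 ≤ N := (abs_nonneg A).trans hA
  have e0 : exp (-l * (u * A + R)) = exp (-l * u * A) * exp (-(l * R)) := by
    rw [← exp_add]; congr 1; ring
  have hlR : 0 ≤ l * R := mul_nonneg hl hR0
  have e1 := exp_neg_le_quad hlR
  have e2 := add_one_le_exp (-l * u * A)
  have e3 : exp (-l * u * A) ≤ exp (l * N) := by
    apply exp_le_exp.2
    have : -(u * A) ≤ N := by
      have := neg_abs_le A
      nlinarith
    nlinarith
  have hE := exp_pos (-l * u * A)
  have s1 : exp (-l * u * A) * exp (-(l * R)) ≤ exp (-l * u * A) * (1 - l * R + (l * R) ^ 2 / 2) :=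
    mul_le_mul_of_nonneg_left e1 hE.le
  have s2 : (1 - l * u * A) * (l * R) ≤ exp (-l * u * A) * (l * R) :=
    mul_le_mul_of_nonneg_right (by linarith) hlR
  have s3 : l ^ 2 * u * (A * R) ≤ u ^ 3 * (l ^ 2 * β * N ^ 3) := by
    have : A * R ≤ N * (β * (u ^ 2 * N ^ 2)) := by
      calc A * R ≤ N * R := mul_le_mul_of_nonneg_right ((le_abs_self A).trans hA) hR0
        _ ≤ _ := mul_le_mul_of_nonneg_left hR hN
    calc l ^ 2 * u * (A * R) ≤ l ^ 2 * u * (N * (β * (u ^ 2 * N ^ 2))) :=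
          mul_le_mul_of_nonneg_left this (by positivity)
      _ = _ := by ring
  have s4 : exp (-l * u * A) * ((l * R) ^ 2 / 2) ≤
      u ^ 3 * (l ^ 2 * β ^ 2 / 2 * (N ^ 4 * exp (l * N))) := by
    have hRR : R ^ 2 ≤ β ^ 2 * (u ^ 3 * N ^ 4) := by
      calc R ^ 2 ≤ (β * (u ^ 2 * N ^ 2)) ^ 2 := pow_le_pow_left₀ hR0 hR 2
        _ = (β ^ 2 * u ^ 3 * N ^ 4) * u := by ring
        _ ≤ (β ^ 2 * u ^ 3 * N ^ 4) * 1 := mul_le_mul_of_nonneg_left hu1 (by positivity)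
        _ = _ := by ring
    calc exp (-l * u * A) * ((l * R) ^ 2 / 2) 
        ≤ exp (l * N) * (l ^ 2 * (β ^ 2 * (u ^ 3 * N ^ 4)) / 2) := by
          rw [mul_pow]
          gcongr
      _ = _ := by ring
  rw [e0]
  linarith

lemma final_real {q t w C1 T : ℝ} (hq : 0 ≤ q) (htT : t ≤ T) 
    (hw : t * (exp q - 1) + C1 ≤ w) (hw0 : 0 ≤ w) :
    exp q - t + C1 ≤ exp (-t + q + exp T * w) := by
  have h1 : exp q * (1 - t) ≤ exp (q - t) := by
    rw [sub_eq_add_neg q, exp_add]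
    have := add_one_le_exp (-t)
    exact mul_le_mul_of_nonneg_left (by linarith) (exp_pos _).le
  have h2 : exp q - t + C1 ≤ exp (q - t) + w := by linarith
  have h3 : w ≤ exp (q - t) * (exp T * w) := by
    rw [← mul_assoc, ← exp_add]
    have : 1 ≤ exp (q - t + T) := one_le_exp (by linarith)
    nlinarith
  have h4 := add_one_le_exp (exp T * w)
  calc _ ≤ exp (q - t) * (1 + exp T * w) := by linarith
    _ ≤ exp (q - t) * exp (exp T * w) := mul_le_mul_of_nonneg_left (by linarith) (exp_pos _).le
    _ = _ := by rw [← exp_add]; congr 1; ring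

lemma Bd.small {n : ℕ} {ν : Measure (Fin n → ℝ)} (G : Good ν) {β l : ℝ} (hβ : 0 ≤ β)
    (hl : 0 ≤ l) : ∃ C, 0 ≤ C ∧ ∀ u, 0 ≤ u → u ≤ 1 → Bd ν β l u (l ^ 2 * u ^ 2 / 2 + C * u ^ 3) := by
  have := G.prob
  set D := ∫ y, (l ^ 2 * β * ‖y‖ ^ 3 + l ^ 2 * β ^ 2 / 2 * (‖y‖ ^ 4 * exp (l * ‖y‖))) ∂ν with hD
  have hDi : Integrable (fun y => l ^ 2 * β * ‖y‖ ^ 3 + l ^ 2 * β ^ 2 / 2 * (‖y‖ ^ 4 * exp (l * ‖y‖))) ν :=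
    ((G.powInt' 3).const_mul _).add ((G.powInt 4 l).const_mul _)
  have hD0 : 0 ≤ D := integral_nonneg fun y => by positivity
  set K := ∫ y, ‖y‖ ^ 2 ∂ν with hK
  have hK0 : 0 ≤ K := integral_nonneg fun y => by positivity
  set Q := exp (l ^ 2 / 2) with hQ
  have hQ0 : 0 < Q := exp_pos _
  refine ⟨exp (l * (β * K)) * (l * (β * K) * (l ^ 2 / 2 * Q) + D), by positivity, ?_⟩
  intro u hu0 hu1 h a H x
  set A : (Fin n → ℝ) → ℝ := fun y => ∑ j, a x j * y j with hA
  set R : (Fin n → ℝ) → ℝ := fun y => h (x + u • y) - h x - u * A y with hR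
  have hAu : ∀ y, ∑ j, a x j * (u • y) j = u * A y := fun y => by
    simp only [hA, Finset.mul_sum, Pi.smul_apply, smul_eq_mul]
    exact Finset.sum_congr rfl fun j _ => by ring
  have hR0 : ∀ y, 0 ≤ R y := fun y => by
    have := H.lower x (u • y)
    rw [hAu] at this
    simp only [hR]; linarith
  have hR1 : ∀ y, R y ≤ β * (u ^ 2 * ‖y‖ ^ 2) := fun y => by
    have := H.upper x (u • y)
    rw [hAu, norm_smul, mul_pow, Real.norm_eq_abs, sq_abs] at this
    exact this
  have hAi : Integrable A ν := G.linInt _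
  have hA0 : ∫ y, A y ∂ν = 0 := G.lin_zero _
  have hRi : Integrable R ν := ((G.hInt H x u).fun_sub (integrable_const _)).fun_sub (hAi.const_mul u)
  have hRint : ∫ y, R y ∂ν = (∫ y, h (x + u • y) ∂ν) - h x := by
    simp only [hR]
    rw [integral_sub ((G.hInt H x u).fun_sub (integrable_const _)) (hAi.const_mul u),
      integral_sub (G.hInt H x u) (integrable_const _), integral_const_mul, hA0]
    simp
  set r := ∫ y, R y ∂ν with hr
  have hr0 : 0 ≤ r := integral_nonneg hR0
  have hr1 : r ≤ β * K * u ^ 2 := by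
    calc r ≤ ∫ y, β * (u ^ 2 * ‖y‖ ^ 2) ∂ν :=
          integral_mono hRi (((G.powInt' 2).const_mul _).const_mul _) hR1
      _ = _ := by rw [integral_const_mul, integral_const_mul]; ring
  have hEi : Integrable (fun y => exp (-l * u * A y)) ν := by
    refine (G.expInt (l * u)).mono' (by fun_prop) (Filter.Eventually.of_forall fun y => ?_)
    rw [Real.norm_of_nonneg (exp_pos _).le]
    apply exp_le_exp.2
    have := (abs_le.1 (simplex_abs (H.nonneg x) (H.sum_one x) y)).1
    have hlu : 0 ≤ l * u := by positivity
    have : -A y ≤ ‖y‖ := by simp only [hA]; linarith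
    nlinarith
  have hE := G.mgf_le (a x) (H.nonneg x) (H.sum_one x) (-l * u)
  have step : ∫ y, exp (-l * (u * A y + R y)) ∂ν ≤ exp (l ^ 2 * u ^ 2 / 2) - l * r + u ^ 3 * D := by
    calc _ ≤ ∫ y, (exp (-l * u * A y) - l * R y
      + u ^ 3 * (l ^ 2 * β * ‖y‖ ^ 3 + l ^ 2 * β ^ 2 / 2 * (‖y‖ ^ 4 * exp (l * ‖y‖)))) ∂ν := by
          refine integral_mono_of_nonneg (Filter.Eventually.of_forall fun y => (exp_pos _).le)
            ((hEi.fun_sub (hRi.const_mul l)).add (hDi.const_mul _)) 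
            (Filter.Eventually.of_forall fun y => ?_)
          exact pointwise_bd hl hu0 hu1 (simplex_abs (H.nonneg x) (H.sum_one x) y) (hR0 y) (hR1 y)
      _ = (∫ y, exp (-l * u * A y) ∂ν) - l * r + u ^ 3 * D := by
          rw [integral_add (hEi.fun_sub (hRi.const_mul l)) (hDi.const_mul _), 
            integral_sub hEi (hRi.const_mul l), integral_const_mul, integral_const_mul]
      _ ≤ _ := by
          have : (-l * u) ^ 2 / 2 = l ^ 2 * u ^ 2 / 2 := by ring
          rw [this] at hE
          linarith
  have hfin := final_real (q := l ^ 2 * u ^ 2 / 2) (t := l * r) (C1 := u ^ 3 * D) (T := l * (β * K))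
    (w := (l * (β * K) * (l ^ 2 / 2 * Q) + D) * u ^ 3) (by positivity)
    (by
      apply mul_le_mul_of_nonneg_left _ hl
      have : u ^ 2 ≤ 1 := by nlinarith
      have : 0 ≤ β * K := by positivity
      nlinarith)
    (by
      have e1 : exp (l ^ 2 * u ^ 2 / 2) - 1 ≤ l ^ 2 / 2 * Q * u ^ 2 := by
        have a1 := add_one_le_exp (-(l ^ 2 * u ^ 2 / 2))
        have a2 : exp (-(l ^ 2 * u ^ 2 / 2)) * exp (l ^ 2 * u ^ 2 / 2) = 1 := by
          rw [← exp_add]; simp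
        have a3 : exp (l ^ 2 * u ^ 2 / 2) ≤ Q := by
          apply exp_le_exp.2
          have : u ^ 2 ≤ 1 := by nlinarith
          nlinarith [sq_nonneg l]
        have a4 := exp_pos (l ^ 2 * u ^ 2 / 2)
        have a5 : exp (l ^ 2 * u ^ 2 / 2) - 1 ≤ l ^ 2 * u ^ 2 / 2 * exp (l ^ 2 * u ^ 2 / 2) := by
          nlinarith
        have a6 : l ^ 2 * u ^ 2 / 2 * exp (l ^ 2 * u ^ 2 / 2) ≤ l ^ 2 * u ^ 2 / 2 * Q :=
          mul_le_mul_of_nonneg_left a3 (by positivity)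
        linarith
      have e2 : l * r ≤ l * (β * K) * u ^ 2 := by
        have := mul_le_mul_of_nonneg_left hr1 hl
        linarith
      have e3 : l * r * (exp (l ^ 2 * u ^ 2 / 2) - 1) ≤ 
          (l * (β * K) * u ^ 2) * (l ^ 2 / 2 * Q * u ^ 2) := by
        apply mul_le_mul e2 e1 _ (by positivity)
        have := one_le_exp (x := l ^ 2 * u ^ 2 / 2) (by positivity)
        linarith
      have e4 : (l * (β * K) * u ^ 2) * (l ^ 2 / 2 * Q * u ^ 2) ≤
          (l * (β * K) * (l ^ 2 / 2 * Q)) * u ^ 3 := by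
        calc _ = (l * (β * K) * (l ^ 2 / 2 * Q)) * u ^ 3 * u := by ring
          _ ≤ (l * (β * K) * (l ^ 2 / 2 * Q)) * u ^ 3 * 1 := 
            mul_le_mul_of_nonneg_left hu1 (by positivity)
          _ = _ := by ring
      linarith)
    (by positivity)
  have hsplit : ∀ y, exp (-l * h (x + u • y)) = exp (-l * h x) * exp (-l * (u * A y + R y)) := by
    intro y
    rw [← exp_add]
    congr 1
    simp only [hR]; ring
  simp only [hsplit]
  rw [integral_const_mul]
  calc _ ≤ exp (-l * h x) * exp (-(l * r) + l ^ 2 * u ^ 2 / 2 + exp (l * (β * K)) * ((l * (β * K) * (l ^ 2 / 2 * Q) + D) * u ^ 3)) :=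
        mul_le_mul_of_nonneg_left (step.trans hfin) (exp_pos _).le
    _ = _ := by
      rw [← exp_add]; congr 1
      rw [hRint]; ring

lemma Bd.one {n : ℕ} {ν : Measure (Fin n → ℝ)} (G : Good ν) {β l : ℝ} (hβ : 0 ≤ β)
    (hl : 0 ≤ l) : Bd ν β l 1 (l ^ 2 / 2) := by
  obtain ⟨C, hC, hB⟩ := Bd.small G hβ hl
  have h2 : √2 * (√2)⁻¹ = 1 := mul_inv_cancel₀ (by positivity)
  have hs2 : (√2)⁻¹ ^ 2 = 1 / 2 := by rw [inv_pow, Real.sq_sqrt (by norm_num)]; norm_num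
  have hlt : (√2)⁻¹ < 1 := by
    rw [inv_lt_one_iff₀]; right
    rw [Real.lt_sqrt] <;> norm_num
  have hpos : 0 < (√2)⁻¹ := by positivity
  have it : ∀ k : ℕ, ∀ u ε, Bd ν β l u ε → Bd ν β l ((√2) ^ k * u) (2 ^ k * ε) := by
    intro k
    induction k with
    | zero => intro u ε h; simpa using h
    | succ k ih =>
      intro u ε h
      have := Bd.double G hl (ih u ε h)
      convert this using 1 <;> ring
  have hk : ∀ k : ℕ, Bd ν β l 1 (l ^ 2 / 2 + C * (√2)⁻¹ ^ k) := by
    intro k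
    have := it k _ _ (hB ((√2)⁻¹ ^ k) (by positivity) (pow_le_one₀ hpos.le hlt.le))
    convert this using 1
    · rw [← mul_pow, h2, one_pow]
    · have e : (2:ℝ) ^ k * ((√2)⁻¹ ^ k) ^ 2 = 1 := by
        rw [← pow_mul, mul_comm k 2, pow_mul, hs2, ← mul_pow]; norm_num
      linear_combination (-l ^ 2 / 2 - C * (√2)⁻¹ ^ k) * e
  intro h a H x
  have hlim : Filter.Tendsto (fun k : ℕ => exp (-l * (∫ y, h (x + (1:ℝ) • y) ∂ν) + 
      (l ^ 2 / 2 + C * (√2)⁻¹ ^ k))) Filter.atTop 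
      (nhds (exp (-l * (∫ y, h (x + (1:ℝ) • y) ∂ν) + (l ^ 2 / 2 + C * 0)))) := by
    have := tendsto_pow_atTop_nhds_zero_of_lt_one hpos.le hlt
    exact (Real.continuous_exp.tendsto _).comp (((this.const_mul C).const_add _).const_add _)
  have := ge_of_tendsto' hlim fun k => hk k h a H x
  simpa using this

lemma simplex_exp {n : ℕ} {a : Fin n → ℝ} (h0 : ∀ j, 0 ≤ a j) (h1 : ∑ j, a j = 1)
    {u : Fin n → ℝ} {c : ℝ} (hu : ∀ j, |u j| ≤ c) :
    (∑ j, a j * exp (u j)) * (∑ j, a j * exp (-u j)) ≤ exp (c ^ 2) := by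
  have h2 : (∑ j, a j * exp (u j)) + (∑ j, a j * exp (-u j)) ≤ 2 * exp (c ^ 2 / 2) := by
    rw [← Finset.sum_add_distrib]
    calc _ ≤ ∑ j, a j * (2 * exp (c ^ 2 / 2)) := by
          refine Finset.sum_le_sum fun j _ => ?_
          rw [← mul_add]
          refine mul_le_mul_of_nonneg_left ?_ (h0 j)
          have e1 := Real.cosh_le_exp_half_sq (u j)
          have e2 : exp (u j ^ 2 / 2) ≤ exp (c ^ 2 / 2) := by
            apply exp_le_exp.2
            have := sq_le_sq' (abs_le.1 (hu j)).1 (abs_le.1 (hu j)).2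
            linarith
          rw [Real.cosh_eq] at e1
          linarith
      _ = _ := by rw [← Finset.sum_mul, h1, one_mul]
  have p1 : 0 ≤ ∑ j, a j * exp (u j) := Finset.sum_nonneg fun j _ => mul_nonneg (h0 j) (exp_pos _).le
  have p2 : 0 ≤ ∑ j, a j * exp (-u j) := Finset.sum_nonneg fun j _ => mul_nonneg (h0 j) (exp_pos _).le
  have e : exp (c ^ 2) = exp (c ^ 2 / 2) ^ 2 := by rw [← exp_nat_mul]; congr 1; push_cast; ring
  rw [e]
  nlinarith [sq_nonneg ((∑ j, a j * exp (u j)) - (∑ j, a j * exp (-u j))), exp_pos (c ^ 2 / 2)]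

lemma simplex_jensen {n : ℕ} {a : Fin n → ℝ} (h0 : ∀ j, 0 ≤ a j) (h1 : ∑ j, a j = 1)
    (u : Fin n → ℝ) : exp (∑ j, a j * u j) ≤ ∑ j, a j * exp (u j) := by
  have := convexOn_exp.map_sum_le (t := Finset.univ) (w := a) (p := u) (fun j _ => h0 j) h1
    (fun j _ => Set.mem_univ _)
  simpa using this

lemma Cls.softmax {n : ℕ} (hn : 1 ≤ n) {β : ℝ} (hβ : 0 < β) :
    Cls (n := n) β (fun x => log (∑ j, exp (β * x j)) / β)
      (fun x j => exp (β * x j) / ∑ k, exp (β * x k)) := by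
  have : Nonempty (Fin n) := ⟨⟨0, hn⟩⟩
  have hS : ∀ x : Fin n → ℝ, 0 < ∑ j, exp (β * x j) := fun x =>
    Finset.sum_pos (fun j _ => exp_pos _) Finset.univ_nonempty
  set a : (Fin n → ℝ) → Fin n → ℝ := fun x j => exp (β * x j) / ∑ k, exp (β * x k) with ha
  have ha0 : ∀ x j, 0 ≤ a x j := fun x j => div_nonneg (exp_pos _).le (hS x).le
  have ha1 : ∀ x, ∑ j, a x j = 1 := fun x => by
    simp only [ha]
    rw [← Finset.sum_div, div_self (hS x).ne']
  have hZ : ∀ x y : Fin n → ℝ, ∑ j, exp (β * (x + y) j) =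
      (∑ j, exp (β * x j)) * ∑ j, a x j * exp (β * y j) := fun x y => by
    rw [Finset.mul_sum]
    refine Finset.sum_congr rfl fun j _ => ?_
    simp only [ha, Pi.add_apply, mul_add, exp_add]
    have := (hS x).ne'
    field_simp
  have hZ0 : ∀ x y : Fin n → ℝ, 0 < ∑ j, a x j * exp (β * y j) := fun x y => by
    have := hS (x + y)
    rw [hZ] at this
    exact pos_of_mul_pos_right this (hS x).le
  have hd : ∀ x y : Fin n → ℝ, log (∑ j, exp (β * (x + y) j)) / β - log (∑ j, exp (β * x j)) / β
      = log (∑ j, a x j * exp (β * y j)) / β := fun x y => by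
    rw [hZ, log_mul (hS x).ne' (hZ0 x y).ne']; ring
  have hlow : ∀ x y : Fin n → ℝ, β * ∑ j, a x j * y j ≤ log (∑ j, a x j * exp (β * y j)) := fun x y => by
    rw [le_log_iff_exp_le (hZ0 x y)]
    have := simplex_jensen (ha0 x) (ha1 x) (fun j => β * y j)
    convert this using 2
    rw [Finset.mul_sum]
    exact Finset.sum_congr rfl fun j _ => by ring
  refine ⟨fun j => ?_, ha0, ha1, fun x y => ?_, fun x y => ?_⟩
  · simp only [ha]
    exact Continuous.div (by fun_prop) (by fun_prop) fun x => (hS x).ne'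
  · rw [hd, le_div_iff₀ hβ]
    linarith [hlow x y]
  · rw [hd]
    have h1 := hlow x (-y)
    have h2 := simplex_exp (ha0 x) (ha1 x) (u := fun j => β * y j) (c := β * ‖y‖) fun j => by
      rw [abs_mul, abs_of_pos hβ]
      exact mul_le_mul_of_nonneg_left (norm_le_pi_norm y j) hβ.le
    have h3 : ∑ j, a x j * exp (-(β * y j)) = ∑ j, a x j * exp (β * (-y) j) := by simp
    rw [h3, ← log_le_iff_le_exp (mul_pos (hZ0 x y) (hZ0 x (-y))), log_mul (hZ0 x y).ne' (hZ0 x (-y)).ne'] at h2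
    have h4 : ∑ j, a x j * (-y) j = - ∑ j, a x j * y j := by simp
    rw [h4] at h1
    have h5 : log (∑ j, a x j * exp (β * y j)) / β ≤ (β ^ 2 * ‖y‖ ^ 2 + β * ∑ j, a x j * y j) / β := by
      apply div_le_div_of_nonneg_right _ hβ.le
      nlinarith
    have h6 : (β ^ 2 * ‖y‖ ^ 2 + β * ∑ j, a x j * y j) / β = β * ‖y‖ ^ 2 + ∑ j, a x j * y j := by
      field_simp
    linarith

lemma Good.max_mgf {n : ℕ} (hn : 1 ≤ n) {ν : Measure (Fin n → ℝ)} (G : Good ν) {l : ℝ} (hl : 0 ≤ l)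
    (hM : Integrable (fun y : Fin n → ℝ => ⨆ j, y j) ν) :
    Integrable (fun y : Fin n → ℝ => exp (-l * ⨆ j, y j)) ν ∧
    ∫ y : Fin n → ℝ, exp (-l * ⨆ j, y j) ∂ν ≤ exp (-l * (∫ y : Fin n → ℝ, (⨆ j, y j) ∂ν) + l ^ 2 / 2) := by
  have := G.prob
  have hne : Nonempty (Fin n) := ⟨⟨0, hn⟩⟩
  have hle : ∀ (y : Fin n → ℝ) j, y j ≤ ⨆ j, y j := fun y j =>
    le_ciSup (Set.finite_range y).bddAbove j
  have hge : ∀ (y : Fin n → ℝ), -‖y‖ ≤ ⨆ j, y j := fun y =>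
    (neg_le_of_abs_le (norm_le_pi_norm y ⟨0, hn⟩)).trans (hle y ⟨0, hn⟩)
  have hMi : Integrable (fun y : Fin n → ℝ => exp (-l * ⨆ j, y j)) ν := by
    refine (G.expInt l).mono' (Real.continuous_exp.comp_aestronglyMeasurable 
      (hM.aestronglyMeasurable.const_mul _)) (Filter.Eventually.of_forall fun y => ?_)
    rw [Real.norm_of_nonneg (exp_pos _).le]
    apply exp_le_exp.2
    nlinarith [hge y]
  refine ⟨hMi, ?_⟩
  have main : ∀ β : ℝ, 0 < β → ∫ y : Fin n → ℝ, exp (-l * ⨆ j, y j) ∂ν ≤ 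
      exp (-l * (∫ y : Fin n → ℝ, (⨆ j, y j) ∂ν) + l ^ 2 / 2 + l * log n * β⁻¹) := by
    intro β hβ
    have H := Cls.softmax hn hβ
    have B := Bd.one G hβ.le hl _ _ H 0
    have I1 := G.hInt H 0 1
    have I2 := G.expHInt H 0 1 l hl
    simp only [zero_add, one_smul] at B I1 I2
    have hS : ∀ x : Fin n → ℝ, 0 < ∑ j, exp (β * x j) := fun x =>
      Finset.sum_pos (fun j _ => exp_pos _) Finset.univ_nonempty
    have up : ∀ y : Fin n → ℝ, log (∑ j, exp (β * y j)) / β ≤ (⨆ j, y j) + log n * β⁻¹ := by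
      intro y
      rw [div_le_iff₀ hβ, add_mul, mul_assoc, inv_mul_cancel₀ hβ.ne', mul_one, 
        log_le_iff_le_exp (hS y), exp_add, exp_log (by exact_mod_cast hn)]
      calc _ ≤ ∑ j : Fin n, exp ((⨆ j, y j) * β) := by
            refine Finset.sum_le_sum fun j _ => exp_le_exp.2 ?_
            nlinarith [hle y j]
        _ = _ := by simp [mul_comm]
    have lo : ∀ y : Fin n → ℝ, (⨆ j, y j) ≤ log (∑ j, exp (β * y j)) / β := by
      intro y
      refine ciSup_le fun j => ?_
      rw [le_div_iff₀ hβ, le_log_iff_exp_le (hS y), mul_comm]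
      exact Finset.single_le_sum (f := fun j => exp (β * y j)) (fun j _ => (exp_pos _).le) (Finset.mem_univ j)
    calc _ ≤ ∫ y : Fin n → ℝ, exp (-l * (log (∑ j, exp (β * y j)) / β)) * exp (l * log n * β⁻¹) ∂ν := by
          refine integral_mono hMi (I2.mul_const _) fun y => ?_
          simp only
          rw [← exp_add]
          apply exp_le_exp.2
          have := mul_le_mul_of_nonneg_left (up y) hl
          linarith
      _ ≤ exp (-l * (∫ y : Fin n → ℝ, log (∑ j, exp (β * y j)) / β ∂ν) + l ^ 2 / 2) * exp (l * log n * β⁻¹) := by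
          rw [integral_mul_const]
          exact mul_le_mul_of_nonneg_right B (exp_pos _).le
      _ ≤ _ := by
          rw [← exp_add]
          apply exp_le_exp.2
          have := mul_le_mul_of_nonneg_left (integral_mono hM I1 lo) hl
          linarith
  have hlim : Filter.Tendsto (fun β : ℝ => exp (-l * (∫ y : Fin n → ℝ, (⨆ j, y j) ∂ν) + l ^ 2 / 2 + l * log n * β⁻¹))
      Filter.atTop (nhds (exp (-l * (∫ y : Fin n → ℝ, (⨆ j, y j) ∂ν) + l ^ 2 / 2 + l * log n * 0))) :=
    (Real.continuous_exp.tendsto _).comp ((tendsto_inv_atTop_zero.const_mul _).const_add _)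
  have := ge_of_tendsto hlim (Filter.eventually_atTop.2 ⟨1, fun β hβ => main β (by linarith)⟩)
  simpa using this

lemma good_of_gauss {n : ℕ} {ν : Measure (Fin n → ℝ)} [IsProbabilityMeasure ν]
    (hg : ∀ a : Fin n → ℝ, ∃ v : NNReal, ν.map (fun y => ∑ i, a i * y i) = gaussianReal 0 v)
    (hvar : ∀ i, ∫ y, y i ^ 2 ∂ν = 1) : Good ν := by
  have hmeas : ∀ a : Fin n → ℝ, Measurable fun y : Fin n → ℝ => ∑ i, a i * y i := fun a => by
    fun_prop
  have hL : ∀ L : (Fin n → ℝ) →L[ℝ] ℝ, ⇑L = fun y => ∑ i, L (Pi.single i 1) * y i := fun L => by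
    funext y
    conv_lhs => rw [pi_eq_sum_univ' y]
    simp only [map_sum, map_smul, smul_eq_mul]
    refine Finset.sum_congr rfl fun i _ => ?_
    rw [mul_comm]
  have hG : IsGaussian ν := isGaussian_of_map_eq_gaussianReal fun L => by
    obtain ⟨v, hv⟩ := hg fun i => L (Pi.single i 1)
    exact ⟨0, v, by rw [hL L]; exact hv⟩
  have hmean : ∀ a : Fin n → ℝ, ∫ y, ∑ i, a i * y i ∂ν = 0 := fun a => by
    obtain ⟨v, hv⟩ := hg a
    have := integral_map (μ := ν) (hmeas a).aemeasurable (f := fun x : ℝ => x) (by fun_prop)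
    rw [← this, hv, integral_id_gaussianReal]
  obtain ⟨C, hC, hCi⟩ := IsGaussian.exists_integrable_exp_sq ν
  have hexp : ∀ c : ℝ, Integrable (fun y => exp (c * ‖y‖)) ν := fun c => by
    refine (hCi.const_mul (exp (c ^ 2 / (4 * C)))).mono' (by fun_prop)
      (Filter.Eventually.of_forall fun y => ?_)
    rw [Real.norm_of_nonneg (exp_pos _).le, ← exp_add]
    apply exp_le_exp.2
    have : c ^ 2 / (4 * C) + C * ‖y‖ ^ 2 - c * ‖y‖ = (c - 2 * C * ‖y‖) ^ 2 / (4 * C) := by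
      field_simp; ring
    have h2 : 0 ≤ (c - 2 * C * ‖y‖) ^ 2 / (4 * C) := by positivity
    linarith
  have hsq : ∀ i, Integrable (fun y => y i ^ 2) ν := fun i => by
    by_contra h
    have := hvar i
    rw [integral_undef h] at this
    norm_num at this
  refine ⟨inferInstance, hexp, fun j => ?_, fun a h0 h1 t => ?_, ?_⟩
  · have := hmean (Pi.single j 1)
    simpa [Pi.single_apply] using this
  · obtain ⟨v, hv⟩ := hg a
    have h := mgf_gaussianReal hv t
    rw [mgf] at h
    rw [h]
    apply exp_le_exp.2
    have hv1 : (v : ℝ) ≤ 1 := by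
      have e1 : ∫ y, (∑ i, a i * y i) ^ 2 ∂ν = v := by
        have := integral_map (μ := ν) (hmeas a).aemeasurable (f := fun x : ℝ => x ^ 2) (by fun_prop)
        rw [← this, hv]
        have h3 := variance_fun_id_gaussianReal (μ := 0) (v := v)
        rw [variance_eq_integral measurable_id'.aemeasurable, integral_id_gaussianReal] at h3
        simpa using h3
      rw [← e1]
      calc _ ≤ ∫ y, ∑ i, a i * y i ^ 2 ∂ν := by
            refine integral_mono_of_nonneg (Filter.Eventually.of_forall fun y => sq_nonneg _)
              (integrable_finsetSum _ fun i _ => (hsq i).const_mul _)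
              (Filter.Eventually.of_forall fun y => ?_)
            have := (Even.convexOn_pow (𝕜 := ℝ) (n := 2) even_two).map_sum_le (t := Finset.univ) 
              (w := a) (p := y) (fun j _ => h0 j) h1 (fun j _ => Set.mem_univ _)
            simpa using this
        _ = 1 := by
            rw [integral_finsetSum _ fun i _ => (hsq i).const_mul _]
            simp [integral_const_mul, hvar, h1]
    nlinarith [sq_nonneg t]
  · have hr := IsGaussian.map_rotation_eq_self_of_forall_strongDual_eq_zero (μ := ν)
      (fun L => by rw [hL L]; exact hmean _) (π / 4)
    have h1 : (ν.prod ν).map Prod.fst = ν := by simp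
    conv_rhs => rw [← h1, ← hr]
    rw [Measure.map_map measurable_fst (by fun_prop)]
    congr 1
    funext p
    simp only [Function.comp, ContinuousLinearMap.rotation_apply, cos_pi_div_four, sin_pi_div_four]
    rw [← smul_add]
    congr 1
    rw [inv_eq_one_div, div_eq_div_iff (by positivity) (by norm_num)]
    simp

theorem prob_coordinate_is_max_le
    {Ω : Type*} [MeasurableSpace Ω] (P : Measure Ω) [IsProbabilityMeasure P]
    (n : ℕ) (hn : 1 ≤ n)
    (X : Fin n → Ω → ℝ) (hXmeas : ∀ i, Measurable (X i))
    -- `X` is a centered Gaussian vector: every linear combination is centered Gaussian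
    (hgauss : ∀ a : Fin n → ℝ, ∃ v : NNReal,
      P.map (fun ω => ∑ i, a i * X i ω) = gaussianReal 0 v)
    -- unit variances
    (hvar : ∀ i, ∫ ω, X i ω ^ 2 ∂P = 1)
    (i : Fin n) :
    (P {ω | X i ω = ⨆ j, X j ω}).toReal ≤
      2 * Real.exp (-(∫ ω, (⨆ j, X j ω) ∂P) ^ 2 / 8) := by
  have hne : Nonempty (Fin n) := ⟨i⟩
  have hXm : Measurable fun ω j => X j ω := measurable_pi_lambda _ hXmeas
  set ν := P.map (fun ω j => X j ω) with hν
  have hpν : IsProbabilityMeasure ν := Measure.isProbabilityMeasure_map hXm.aemeasurable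
  have G : Good ν := by
    refine good_of_gauss (fun a => ?_) fun j => ?_
    · obtain ⟨v, hv⟩ := hgauss a
      refine ⟨v, ?_⟩
      rw [hν, Measure.map_map (by fun_prop) hXm]
      exact hv
    · rw [hν, integral_map hXm.aemeasurable ((measurable_pi_apply j).pow_const 2).aestronglyMeasurable]
      exact hvar j
  have hle : ∀ (y : Fin n → ℝ) j, y j ≤ ⨆ j, y j := fun y j =>
    le_ciSup (Set.finite_range y).bddAbove j
  have hMm : Measurable fun y : Fin n → ℝ => ⨆ j, y j := Measurable.iSup fun j => measurable_pi_apply j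
  have hMi : Integrable (fun y : Fin n → ℝ => ⨆ j, y j) ν := by
    refine G.normInt.mono' hMm.aestronglyMeasurable (Filter.Eventually.of_forall fun y => ?_)
    rw [Real.norm_eq_abs, abs_le]
    exact ⟨(neg_le_of_abs_le (norm_le_pi_norm y i)).trans (hle y i),
      ciSup_le fun j => (le_abs_self _).trans (norm_le_pi_norm y j)⟩
  have hm : ∫ ω, (⨆ j, X j ω) ∂P = ∫ y : Fin n → ℝ, (⨆ j, y j) ∂ν := by
    rw [hν, integral_map hXm.aemeasurable hMm.aestronglyMeasurable]
  have hset : (P {ω | X i ω = ⨆ j, X j ω}).toReal = ν.real {y | y i = ⨆ j, y j} := by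
    rw [Measure.real, hν, Measure.map_apply hXm (measurableSet_eq_fun (measurable_pi_apply i) hMm)]
    rfl
  rw [hm, hset]
  set m := ∫ y : Fin n → ℝ, (⨆ j, y j) ∂ν with hmdef
  have hm0 : 0 ≤ m := by
    rw [← G.mean i]
    exact integral_mono (G.coordInt i) hMi fun y => hle y i
  have hl : 0 ≤ m / 2 := by linarith
  obtain ⟨hi1, hb1⟩ := G.max_mgf hn hl hMi
  have t1 : ν.real {y : Fin n → ℝ | (⨆ j, y j) ≤ m / 2} ≤ exp (-m ^ 2 / 8) := by
    refine (measure_le_le_exp_mul_mgf (m / 2) (t := -(m / 2)) (by linarith) hi1).trans ?_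
    calc _ ≤ exp (-(-(m / 2)) * (m / 2)) * exp (-(m / 2) * m + (m / 2) ^ 2 / 2) :=
          mul_le_mul_of_nonneg_left hb1 (exp_pos _).le
      _ = _ := by rw [← exp_add]; congr 1; ring
  have t2 : ν.real {y : Fin n → ℝ | m / 2 ≤ y i} ≤ exp (-m ^ 2 / 8) := by
    have hb2 := G.mgf_le (Pi.single i 1) (fun j => by rw [Pi.single_apply]; split_ifs <;> norm_num) 
      (by simp) (m / 2)
    have hs : ∀ y : Fin n → ℝ, ∑ j, (Pi.single i 1 : Fin n → ℝ) j * y j = y i := fun y => by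
      simp [Pi.single_apply]
    simp only [hs] at hb2
    have hmi : Measurable fun y : Fin n → ℝ => y i := measurable_pi_apply i
    have hi2 : Integrable (fun y : Fin n → ℝ => exp (m / 2 * y i)) ν := by
      refine (G.expInt (m / 2)).mono' (hmi.const_mul (m / 2)).exp.aestronglyMeasurable (Filter.Eventually.of_forall fun y => ?_)
      rw [Real.norm_of_nonneg (exp_pos _).le]
      exact exp_le_exp.2 (mul_le_mul_of_nonneg_left ((le_abs_self _).trans (norm_le_pi_norm y i)) hl)
    refine (measure_ge_le_exp_mul_mgf (m / 2) hl hi2).trans ?_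
    calc _ ≤ exp (-(m / 2) * (m / 2)) * exp ((m / 2) ^ 2 / 2) :=
          mul_le_mul_of_nonneg_left hb2 (exp_pos _).le
      _ = _ := by rw [← exp_add]; congr 1; ring
  have hsub : {y : Fin n → ℝ | y i = ⨆ j, y j} ⊆ 
      {y : Fin n → ℝ | (⨆ j, y j) ≤ m / 2} ∪ {y : Fin n → ℝ | m / 2 ≤ y i} := by
    intro y hy
    rcases le_total (⨆ j, y j) (m / 2) with h | h
    · exact Or.inl h
    · exact Or.inr (h.trans_eq hy.symm)
  calc _ ≤ _ := measureReal_mono hsub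
    _ ≤ _ := measureReal_union_le _ _
    _ ≤ _ := by linarith
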